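/- Assume N ≥ 2 and |G| ≥ 2. The smallest subset of L(H_N) that contains Π_inv(|ψ⟩⟨ψ|) for every alignable vector ψ ∈ H_N and is closed under complex linear combinations and operator products equals A_alg := {B + Σ_{h∈G^{N−1}} a_h Π_{h;χ≠𝟙} : B ∈ A_phys, a_h ∈ ℂ}. -/

import Mathlib

noncomputable section

open Matrix

namespace QRF

section Defs

variable (G : Type) [Fintype G] [DecidableEq G] [CommGroup G]

/-- The `K`-particle Hilbert space `ℂ^{G^K}` (as functions `G^K → ℂ`). -/
abbrev Vec (K : ℕ) : Type := (Fin K → G) → ℂ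

/-- Linear operators on the `K`-particle Hilbert space. -/
abbrev Op (K : ℕ) : Type := Matrix (Fin K → G) (Fin K → G) ℂ

variable {G}

/-- The standard basis vector `|x⟩`. -/
def ket {K : ℕ} (x : Fin K → G) : Vec G K := fun y => if y = x then 1 else 0

/-- The global translation `T_g`, `T_g |x₁,…,x_K⟩ = |g x₁, …, g x_K⟩`. -/
def trans {K : ℕ} (g : G) : Op G K :=
  Matrix.of fun x y => if x = (fun i => g * y i) then 1 else 0

/-- The configuration `(g, h₁ g, …, h_k g)`, i.e. `|g, hg⟩`. -/
def cfg {k : ℕ} (h : Fin k → G) (g : G) : Fin (k + 1) → G :=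
  Fin.cons g fun i => h i * g

/-- The inner product `⟨v, w⟩` (antilinear in the first argument). -/
def inn {K : ℕ} (v w : Vec G K) : ℂ := star v ⬝ᵥ w

/-- The rank-one operator `|v⟩⟨w|`. -/
def outer {K : ℕ} (v w : Vec G K) : Op G K :=
  Matrix.of fun x y => v x * (starRingEnd ℂ) (w y)

/-- The matrix element `⟨v|A|w⟩`. -/
def melem {K : ℕ} (v : Vec G K) (A : Op G K) (w : Vec G K) : ℂ :=
  star v ⬝ᵥ A.mulVec w

/-- The Hilbert–Schmidt inner product `⟨A,B⟩ := tr(A† B)`. -/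
def hsInner {K : ℕ} (A B : Op G K) : ℂ := (Aᴴ * B).trace

variable (G)

/-- The symmetry group `U_sym` of relation-conditional global translations
(for `k+1` particles). -/
def Usym (k : ℕ) : Set (Op G (k + 1)) :=
  {U | U ∈ Matrix.unitaryGroup (Fin (k + 1) → G) ℂ ∧
    ∃ c : (Fin k → G) → G, ∀ (h : Fin k → G) (g : G),
      U.mulVec (ket (cfg h g)) = (trans (c h)).mulVec (ket (cfg h g))}

/-- The characters of `G`: monoid homomorphisms `G → ℂ` of modulus one. -/
def Ghat : Type := {χ : G →* ℂ // ∀ g : G, ‖χ g‖ = 1}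

/-- The trivial character `𝟙`. -/
instance : One (Ghat G) := ⟨⟨1, fun g => by simp⟩⟩

variable {G}

/-- The vector `|h;χ⟩ := |G|^{-1/2} ∑_{g ∈ G} χ(g⁻¹) |g, hg⟩`. -/
def relKet {k : ℕ} (h : Fin k → G) (χ : Ghat G) : Vec G (k + 1) :=
  ((Real.sqrt (Fintype.card G) : ℂ))⁻¹ • ∑ g : G, χ.1 g⁻¹ • ket (cfg h g)

variable (G)

/-- The relational subspace `H_phys = span{|h;𝟙⟩}`. -/
def Hphys (k : ℕ) : Submodule ℂ (Vec G (k + 1)) :=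
  Submodule.span ℂ {v | ∃ h : Fin k → G, v = relKet h (1 : Ghat G)}

/-- `Π_phys = ∑_h |h;𝟙⟩⟨h;𝟙|`, the orthogonal projection onto `H_phys`. -/
def Piphys (k : ℕ) : Op G (k + 1) :=
  ∑ h : Fin k → G, outer (relKet h (1 : Ghat G)) (relKet h (1 : Ghat G))

variable {G}

/-- `Π_{h;χ≠𝟙} = ∑_{χ ∈ Ĝ, χ ≠ 𝟙} |h;χ⟩⟨h;χ|`. -/
def PiNot1 {k : ℕ} (h : Fin k → G) : Op G (k + 1) :=
  ∑ᶠ (χ : Ghat G) (_ : χ ≠ 1), outer (relKet h χ) (relKet h χ)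

variable (G)

/-- The invariant algebra `A_inv`. -/
def Ainv (k : ℕ) : Set (Op G (k + 1)) :=
  {A | ∀ U ∈ Usym G k, U * A * Uᴴ = A}

/-- The incoherent group average (twirl) `Π_inv` over `U_sym`. -/
def Piinv (k : ℕ) (ρ : Op G (k + 1)) : Op G (k + 1) :=
  (Nat.card ↥(Usym G k) : ℂ)⁻¹ • ∑ᶠ U ∈ Usym G k, U * ρ * Uᴴ

/-- The algebra `A_phys` of relational observables (operators supported on `H_phys`). -/
def Aphys (k : ℕ) : Set (Op G (k + 1)) :=
  {A | A = Piphys G k * A * Piphys G k}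

/-- The algebra `A_alg`. -/
def Aalg (k : ℕ) : Set (Op G (k + 1)) :=
  {X | ∃ B ∈ Aphys G k, ∃ a : (Fin k → G) → ℂ,
      X = B + ∑ h : Fin k → G, a h • PiNot1 h}

variable {G}

/-- The vector `|e⟩_i ⊗ φ`. -/
def insVec {k : ℕ} (i : Fin (k + 1)) (φ : (Fin k → G) → ℂ) : Vec G (k + 1) :=
  fun x => if x i = 1 then φ (fun j => x (i.succAbove j)) else 0

/-- The operator `|e⟩⟨e|_i ⊗ A`. -/
def eAop {k : ℕ} (i : Fin (k + 1)) (A : Matrix (Fin k → G) (Fin k → G) ℂ) :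
    Op G (k + 1) :=
  Matrix.of fun x y =>
    if x i = 1 ∧ y i = 1 then
      A (fun j => x (i.succAbove j)) (fun j => y (i.succAbove j))
    else 0

/-- `ψ` is `i`-alignable. -/
def IAlignable {k : ℕ} (i : Fin (k + 1)) (ψ : Vec G (k + 1)) : Prop :=
  ∃ (θ : ℝ) (U : Op G (k + 1)) (φ : (Fin k → G) → ℂ),
    U ∈ Usym G k ∧ ψ = Complex.exp (θ * Complex.I) • U.mulVec (insVec i φ)

/-- `ψ` is alignable. -/
def Alignable {k : ℕ} (ψ : Vec G (k + 1)) : Prop := ∃ i, IAlignable i ψ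

/-- Symmetry equivalence of state vectors (up to a global phase). -/
def SymmEquiv {k : ℕ} (ψ ψ' : Vec G (k + 1)) : Prop :=
  ∃ (θ : ℝ) (U : Op G (k + 1)),
    U ∈ Usym G k ∧ ψ' = Complex.exp (θ * Complex.I) • U.mulVec ψ

/-- `P` is the orthogonal projection of operator space onto the set `S`,
with respect to the Hilbert–Schmidt inner product. -/
def IsHSProj {K : ℕ} (S : Set (Op G K)) (P : Op G K →ₗ[ℂ] Op G K) : Prop :=
  (∀ ρ, P ρ ∈ S) ∧ (∀ A ∈ S, P A = A) ∧
    ∀ ρ σ, hsInner (P ρ) σ = hsInner ρ (P σ)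

/-- First `n+1` components of an `(n+1)+(m+1)`-particle configuration. -/
def split1 {n m : ℕ} (x : Fin (n + m + 1 + 1) → G) : Fin (n + 1) → G :=
  fun i => x ⟨i.1, by have := i.2; omega⟩

/-- Last `m+1` components of an `(n+1)+(m+1)`-particle configuration. -/
def split2 {n m : ℕ} (x : Fin (n + m + 1 + 1) → G) : Fin (m + 1) → G :=
  fun i => x ⟨n + 1 + i.1, by have := i.2; omega⟩

/-- The tensor product `A ⊗ B` of operators, under the identification
`H_{N+M} ≅ H_N ⊗ H_M`, `|x,y⟩ ↦ |x⟩ ⊗ |y⟩`. -/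
def tensorOp {n m : ℕ} (A : Op G (n + 1)) (B : Op G (m + 1)) :
    Op G (n + m + 1 + 1) :=
  Matrix.of fun x y => A (split1 x) (split1 y) * B (split2 x) (split2 y)

/-- Concatenation `(h, g⃗)` of relation tuples. -/
def relcat {n m : ℕ} (h : Fin n → G) (gv : Fin (m + 1) → G) :
    Fin (n + m + 1) → G :=
  (Fin.append h gv : Fin (n + (m + 1)) → G)

/-- Joining of configurations `(x, z)`. -/
def join {n m : ℕ} (x : Fin (n + 1) → G) (z : Fin (m + 1) → G) :
    Fin (n + m + 1 + 1) → G :=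
  fun i => if hi : i.1 < n + 1 then x ⟨i.1, hi⟩
           else z ⟨i.1 - (n + 1), by have := i.2; omega⟩

/-- The standard partial trace over the last `m+1` particles. -/
def ptraceM {n m : ℕ} (ρ : Op G (n + m + 1 + 1)) : Op G (n + 1) :=
  Matrix.of fun x y => ∑ z : Fin (m + 1) → G, ρ (join x z) (join y z)

end Defs

section Relations

variable {G : Type} [CommGroup G] {k : ℕ}

/-- The relations `x_{i+1} x_0⁻¹` of a configuration. -/
def rel (x : Fin (k + 1) → G) : Fin k → G := fun i => x i.succ * (x 0)⁻¹

lemma rel_cfg (h : Fin k → G) (g : G) : rel (cfg h g) = h := by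
  ext i; simp [rel, cfg]

lemma cfg_zero (h : Fin k → G) (g : G) : cfg h g 0 = g := rfl

lemma cfg_rel (x : Fin (k + 1) → G) : cfg (rel x) (x 0) = x := by
  ext i
  refine Fin.cases rfl (fun j => ?_) i
  simp [rel, cfg]

lemma rel_mul_left (g : G) (x : Fin (k + 1) → G) : rel (fun i => g * x i) = rel x := by
  ext i
  simp only [rel, mul_inv]
  rw [mul_mul_mul_comm, mul_inv_cancel, one_mul]

lemma ext_rel {x y : Fin (k + 1) → G} (h : rel x = rel y) (h₀ : x 0 = y 0) : x = y := by
  rw [← cfg_rel x, ← cfg_rel y, h, h₀]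

lemma eq_cfg_iff {x : Fin (k + 1) → G} {h : Fin k → G} {g : G} :
    x = cfg h g ↔ rel x = h ∧ x 0 = g := by
  constructor
  · rintro rfl
    exact ⟨rel_cfg h g, cfg_zero h g⟩
  · rintro ⟨rfl, rfl⟩
    exact (cfg_rel x).symm

/-- Configurations are relations together with the position of the first particle. -/
def cfgEquiv : (Fin k → G) × G ≃ (Fin (k + 1) → G) where
  toFun p := cfg p.1 p.2
  invFun x := (rel x, x 0)
  left_inv p := Prod.ext (rel_cfg p.1 p.2) (cfg_zero p.1 p.2)
  right_inv x := cfg_rel x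

/-- The relation-conditional translation of configurations. -/
def relTrans (c : (Fin k → G) → G) : Equiv.Perm (Fin (k + 1) → G) where
  toFun x := fun i => c (rel x) * x i
  invFun x := fun i => (c (rel x))⁻¹ * x i
  left_inv x := by ext i; simp [rel_mul_left]
  right_inv x := by ext i; simp [rel_mul_left]

lemma relTrans_symm_apply (c : (Fin k → G) → G) (x : Fin (k + 1) → G) :
    (relTrans c).symm x = fun i => (c (rel x))⁻¹ * x i := rfl

lemma Ghat.conj_apply (χ : Ghat G) (g : G) : (starRingEnd ℂ) (χ.1 g) = χ.1 g⁻¹ := by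
  rw [← Complex.inv_eq_conj (χ.2 g)]
  exact inv_eq_of_mul_eq_one_right (by rw [← map_mul, mul_inv_cancel, map_one])

end Relations

section Averages

variable {G ι : Type} [Fintype G] [Group G] [Fintype ι] [DecidableEq ι]

lemma card_mul_sum_eval (F : G → ℂ) (i : ι) :
    (Fintype.card G : ℂ) * ∑ c : ι → G, F (c i) =
      (Fintype.card (ι → G) : ℂ) * ∑ a, F a := by
  have hshift (a : G) : ∑ c : ι → G, F (c i) = ∑ c : ι → G, F (a * c i) := by
    rw [← Equiv.sum_comp (Equiv.mulLeft (Pi.mulSingle i a : ι → G))]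
    simp
  have hright (c : ι → G) : ∑ a, F (a * c i) = ∑ a, F a :=
    Equiv.sum_comp (Equiv.mulRight (c i)) F
  calc (Fintype.card G : ℂ) * ∑ c : ι → G, F (c i)
      = ∑ a : G, ∑ c : ι → G, F (a * c i) := by simp [← hshift]
    _ = _ := by rw [Finset.sum_comm]; simp [hright]

lemma card_sq_mul_sum_eval₂ (F H : G → ℂ) {i j : ι} (hij : i ≠ j) :
    (Fintype.card G : ℂ) ^ 2 * ∑ c : ι → G, F (c i) * H (c j) =
      (Fintype.card (ι → G) : ℂ) * ((∑ a, F a) * ∑ b, H b) := by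
  have hshift (a b : G) :
      ∑ c : ι → G, F (c i) * H (c j) = ∑ c : ι → G, F (a * c i) * H (b * c j) := by
    rw [← Equiv.sum_comp
      (Equiv.mulLeft (Pi.mulSingle i a * Pi.mulSingle j b : ι → G))]
    simp [Pi.mulSingle_eq_of_ne hij, Pi.mulSingle_eq_of_ne hij.symm]
  have hright (K : G → ℂ) (g : G) : ∑ a, K (a * g) = ∑ a, K a :=
    Equiv.sum_comp (Equiv.mulRight g) K
  calc (Fintype.card G : ℂ) ^ 2 * ∑ c : ι → G, F (c i) * H (c j)
      = ∑ a : G, ∑ b : G, ∑ c : ι → G, F (a * c i) * H (b * c j) := by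
        simp [← hshift]; ring
    _ = ∑ c : ι → G, ∑ a : G, ∑ b : G, F (a * c i) * H (b * c j) := by
        rw [Finset.sum_congr rfl fun a _ => Finset.sum_comm, Finset.sum_comm]
    _ = _ := by
        simp_rw [← Finset.sum_mul_sum, hright]
        simp

end Averages

section General

variable {G : Type} [Fintype G]

lemma sqrt_card_inv_sq :
    ((Real.sqrt (Fintype.card G) : ℂ))⁻¹ * ((Real.sqrt (Fintype.card G) : ℂ))⁻¹ =
      (Fintype.card G : ℂ)⁻¹ := by
  rw [← mul_inv, ← Complex.ofReal_mul, Real.mul_self_sqrt (Nat.cast_nonneg _),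
    Complex.ofReal_natCast]

lemma card_ne_zero [Nonempty G] : (Fintype.card G : ℂ) ≠ 0 := Nat.cast_ne_zero.2 Fintype.card_ne_zero

lemma outer_mul_mul_outer {K : ℕ} (u v w z : Vec G K) (A : Op G K) :
    outer u v * A * outer w z = melem v A w • outer u z := by
  have houter (a b : Vec G K) : outer a b = Matrix.vecMulVec a (star b) := rfl
  rw [houter, houter, houter, Matrix.vecMulVec_mul, Matrix.vecMulVec_mul_vecMulVec, melem,
    Matrix.dotProduct_mulVec]
  ext x y
  simp [Matrix.vecMulVec_apply]
  ring

lemma mulVec_ket [DecidableEq G] {K : ℕ} (A : Op G K) (x y : Fin K → G) : A.mulVec (ket x) y = A y x := by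
  simp [ket, Matrix.mulVec, dotProduct]

end General

section Blocks

variable {G : Type} [Fintype G] [DecidableEq G] [CommGroup G] {k : ℕ}

/-- The operator `|h₁;𝟙⟩⟨h₂;𝟙|`. -/
def relUnit (h₁ h₂ : Fin k → G) : Op G (k + 1) := outer (relKet h₁ 1) (relKet h₂ 1)

/-- The projection onto the configurations with relations `h`. -/
def relProj (h : Fin k → G) : Op G (k + 1) :=
  Matrix.diagonal fun x => if rel x = h then 1 else 0

lemma relKet_apply (h : Fin k → G) (χ : Ghat G) (x : Fin (k + 1) → G) :
    relKet h χ x =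
      ((Real.sqrt (Fintype.card G) : ℂ))⁻¹ * if rel x = h then χ.1 (x 0)⁻¹ else 0 := by
  simp only [relKet, ket, Pi.smul_apply, Finset.sum_apply, smul_eq_mul, eq_cfg_iff]
  by_cases hx : rel x = h <;> simp [hx]

lemma relUnit_apply (h h' : Fin k → G) (x y : Fin (k + 1) → G) :
    relUnit h h' x y = if rel x = h ∧ rel y = h' then (Fintype.card G : ℂ)⁻¹ else 0 := by
  have h1 (g : G) : (1 : Ghat G).1 g = 1 := rfl
  simp only [relUnit, outer, Matrix.of_apply, relKet_apply, h1, ← sqrt_card_inv_sq (G := G)]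
  by_cases hx : rel x = h <;> by_cases hy : rel y = h' <;> simp [hx, hy]

lemma sum_relFiber (h : Fin k → G) (a : ℂ) :
    (∑ x : Fin (k + 1) → G, if rel x = h then a else 0) = Fintype.card G * a := by
  rw [← Equiv.sum_comp cfgEquiv, Fintype.sum_prod_type]
  simp [cfgEquiv, rel_cfg]

lemma relUnit_mul_relUnit (h₁ h₂ h₃ h₄ : Fin k → G) :
    relUnit h₁ h₂ * relUnit h₃ h₄ = if h₂ = h₃ then relUnit h₁ h₄ else 0 := by
  ext x z
  rw [Matrix.mul_apply]
  simp only [relUnit_apply]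
  split_ifs with h
  · subst h
    have := sum_relFiber h₂ (if rel x = h₁ ∧ rel z = h₄ then
      (Fintype.card G : ℂ)⁻¹ * (Fintype.card G : ℂ)⁻¹ else 0)
    rw [relUnit_apply]
    convert this using 1
    · refine Finset.sum_congr rfl fun y _ => ?_
      by_cases hx : rel x = h₁ <;> by_cases hz : rel z = h₄ <;> simp [hx, hz]
    · split_ifs <;> simp [card_ne_zero (G := G)]
  · rw [Matrix.zero_apply]
    refine Finset.sum_eq_zero fun y _ => ?_
    by_cases hy : rel y = h₂ <;> simp_all

lemma relProj_mul_relUnit (h h₁ h₂ : Fin k → G) :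
    relProj h * relUnit h₁ h₂ = if h = h₁ then relUnit h₁ h₂ else 0 := by
  ext x y
  rw [relProj, Matrix.diagonal_mul]
  split_ifs with hx hh hh <;> (simp [relUnit_apply, *]; try aesop)

lemma relUnit_mul_relProj (h h₁ h₂ : Fin k → G) :
    relUnit h₁ h₂ * relProj h = if h₂ = h then relUnit h₁ h₂ else 0 := by
  ext x y
  rw [relProj, Matrix.mul_diagonal]
  split_ifs with hx hh hh <;> (simp [relUnit_apply, *]; try aesop)

lemma relProj_mul_relProj (h h' : Fin k → G) :
    relProj h * relProj h' = if h = h' then relProj h else 0 := by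
  rw [relProj, relProj, Matrix.diagonal_mul_diagonal]
  split_ifs with hh
  · subst hh; simp
  · rw [← Matrix.diagonal_zero]
    congr 1
    ext x
    by_cases hx : rel x = h <;> simp_all

/-- Characters of modulus one are the complex additive characters of `Additive G`. -/
def ghatEquiv : Ghat G ≃ AddChar (Additive G) ℂ where
  toFun χ :=
    { toFun := fun g => χ.1 g.toMul
      map_zero_eq_one' := map_one χ.1
      map_add_eq_mul' := fun a b => map_mul χ.1 a.toMul b.toMul }
  invFun ψ :=
    ⟨{ toFun := fun g => ψ (Additive.ofMul g)
       map_one' := ψ.map_zero_eq_one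
       map_mul' := fun a b => ψ.map_add_eq_mul (Additive.ofMul a) (Additive.ofMul b) },
      fun g => ψ.norm_apply (Additive.ofMul g)⟩
  left_inv _ := rfl
  right_inv _ := rfl

instance : Fintype (Ghat G) := Fintype.ofEquiv _ (ghatEquiv (G := G)).symm

lemma sum_ghat_apply (g : G) :
    ∑ χ : Ghat G, χ.1 g = if g = 1 then (Fintype.card G : ℂ) else 0 := by
  rw [← Equiv.sum_comp (ghatEquiv (G := G)).symm]
  have hsymm (ψ : AddChar (Additive G) ℂ) :
      ((ghatEquiv (G := G)).symm ψ).1 g = ψ (Additive.ofMul g) := rfl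
  simpa [hsymm] using AddChar.sum_apply_eq_ite (Additive.ofMul g)

lemma sum_outer_relKet (h : Fin k → G) :
    ∑ χ : Ghat G, outer (relKet h χ) (relKet h χ) = relProj h := by
  ext x y
  have hterm (χ : Ghat G) : outer (relKet h χ) (relKet h χ) x y =
      if rel x = h ∧ rel y = h then (Fintype.card G : ℂ)⁻¹ * χ.1 ((x 0)⁻¹ * y 0) else 0 := by
    simp only [outer, Matrix.of_apply, relKet_apply, map_mul, apply_ite (starRingEnd ℂ),
      Ghat.conj_apply, ← sqrt_card_inv_sq (G := G), map_inv₀, Complex.conj_ofReal, inv_inv,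
      map_zero]
    by_cases hx : rel x = h <;> by_cases hy : rel y = h <;> simp [hx, hy]
    ring
  rw [Matrix.sum_apply]
  simp only [hterm, relProj, Matrix.diagonal_apply]
  by_cases hxy : rel x = h ∧ rel y = h
  · have : x = y ↔ x 0 = y 0 :=
      ⟨fun e => e ▸ rfl, ext_rel (hxy.1.trans hxy.2.symm)⟩
    simp only [hxy, and_self, if_true, ← Finset.mul_sum, sum_ghat_apply, inv_mul_eq_one, this]
    split_ifs <;> simp [card_ne_zero (G := G)]
  · simp only [hxy, if_false, Finset.sum_const_zero]
    aesop

lemma PiNot1_eq (h : Fin k → G) : PiNot1 h = relProj h - relUnit h h := by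
  classical
  have hfin : PiNot1 h =
      ∑ χ ∈ Finset.univ.filter (· ≠ (1 : Ghat G)), outer (relKet h χ) (relKet h χ) := by
    refine finsum_mem_eq_sum_of_inter_support_eq (s := {χ | χ ≠ 1}) _ ?_
    ext; simp
  rw [hfin, ← sum_outer_relKet, relUnit, eq_sub_iff_add_eq, Finset.filter_ne',
    Finset.sum_erase_add _ _ (Finset.mem_univ _)]

lemma PiNot1_mul_PiNot1 (h h' : Fin k → G) :
    PiNot1 h * PiNot1 h' = if h = h' then PiNot1 h else 0 := by
  simp only [PiNot1_eq, mul_sub, sub_mul, relProj_mul_relProj, relProj_mul_relUnit,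
    relUnit_mul_relProj, relUnit_mul_relUnit]
  split_ifs with hh
  · subst hh; simp
  · simp

lemma Piphys_eq : Piphys G k = ∑ h, relUnit h h := rfl

lemma PiNot1_mul_Piphys (h : Fin k → G) : PiNot1 h * Piphys G k = 0 := by
  simp [Piphys_eq, PiNot1_eq, Finset.mul_sum, sub_mul, relProj_mul_relUnit,
    relUnit_mul_relUnit]

lemma Piphys_mul_PiNot1 (h : Fin k → G) : Piphys G k * PiNot1 h = 0 := by
  simp [Piphys_eq, PiNot1_eq, Finset.sum_mul, mul_sub, relUnit_mul_relProj,
    relUnit_mul_relUnit]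

lemma Piphys_mul_mul_Piphys (A : Op G (k + 1)) :
    Piphys G k * A * Piphys G k =
      ∑ h, ∑ h', melem (relKet h 1) A (relKet h' 1) • relUnit h h' := by
  simp only [Piphys_eq, Finset.sum_mul, Finset.mul_sum]
  rw [Finset.sum_comm]
  exact Finset.sum_congr rfl fun h _ => Finset.sum_congr rfl fun h' _ =>
    outer_mul_mul_outer _ _ _ _ _

lemma Piphys_mul_self : Piphys G k * Piphys G k = Piphys G k := by
  simp [Piphys_eq, Finset.sum_mul, Finset.mul_sum, relUnit_mul_relUnit]

lemma relUnit_mem_Aphys (h h' : Fin k → G) : relUnit h h' ∈ Aphys G k := by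
  simp [Aphys, Piphys_eq, Finset.sum_mul, Finset.mul_sum, relUnit_mul_relUnit]

lemma mul_Piphys_of_mem_Aphys {B : Op G (k + 1)} (hB : B ∈ Aphys G k) :
    B * Piphys G k = B := by
  rw [Aphys, Set.mem_ofPred_eq] at hB
  rw [hB, mul_assoc, Piphys_mul_self]

lemma Piphys_mul_of_mem_Aphys {B : Op G (k + 1)} (hB : B ∈ Aphys G k) :
    Piphys G k * B = B := by
  rw [Aphys, Set.mem_ofPred_eq] at hB
  rw [hB, ← mul_assoc, ← mul_assoc, Piphys_mul_self]

variable (G k) in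
/-- `A_alg` as a non-unital subalgebra. -/
def algSubalgebra : NonUnitalSubalgebra ℂ (Op G (k + 1)) where
  carrier := Aalg G k
  zero_mem' := ⟨0, by simp [Aphys], 0, by simp⟩
  add_mem' := by
    rintro _ _ ⟨B, hB, a, rfl⟩ ⟨B', hB', a', rfl⟩
    refine ⟨B + B', ?_, a + a', ?_⟩
    · rw [Aphys, Set.mem_ofPred_eq] at *
      rw [mul_add, add_mul, ← hB, ← hB']
    · simp only [Pi.add_apply, add_smul, Finset.sum_add_distrib]
      abel
  smul_mem' := by
    rintro r _ ⟨B, hB, a, rfl⟩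
    refine ⟨r • B, ?_, r • a, ?_⟩
    · rw [Aphys, Set.mem_ofPred_eq] at *
      rw [Matrix.mul_smul, Matrix.smul_mul, ← hB]
    · simp [smul_add, Finset.smul_sum, mul_smul]
  mul_mem' := by
    rintro _ _ ⟨B, hB, a, rfl⟩ ⟨B', hB', a', rfl⟩
    refine ⟨B * B', ?_, a * a', ?_⟩
    · rw [Aphys, Set.mem_ofPred_eq, ← mul_assoc, Piphys_mul_of_mem_Aphys hB, mul_assoc,
        mul_Piphys_of_mem_Aphys hB']
    · have hleft (h : Fin k → G) : B * PiNot1 h = 0 := by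
        rw [← mul_Piphys_of_mem_Aphys hB, mul_assoc, Piphys_mul_PiNot1, mul_zero]
      have hright (h : Fin k → G) : PiNot1 h * B' = 0 := by
        rw [← Piphys_mul_of_mem_Aphys hB', ← mul_assoc, PiNot1_mul_Piphys, zero_mul]
      simp [mul_add, add_mul, Finset.mul_sum, Finset.sum_mul, hleft, hright,
        PiNot1_mul_PiNot1, smul_smul, mul_comm]

lemma relUnit_mem_algSubalgebra (h h' : Fin k → G) : relUnit h h' ∈ algSubalgebra G k :=
  ⟨relUnit h h', relUnit_mem_Aphys h h', 0, by simp⟩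

lemma relProj_mem_algSubalgebra (h : Fin k → G) : relProj h ∈ algSubalgebra G k :=
  ⟨relUnit h h, relUnit_mem_Aphys h h, Pi.single h 1, by
    simp [Pi.single_apply, PiNot1_eq]⟩

end Blocks

section Symmetries

variable {G : Type} [DecidableEq G] [CommGroup G] {k : ℕ}

/-- The unitary implementing the relation-conditional translation by `c`. -/
def symOp (c : (Fin k → G) → G) : Op G (k + 1) :=
  Matrix.of fun x y => if (relTrans c).symm x = y then 1 else 0

lemma symOp_apply_cfg (c : (Fin k → G) → G) (h : Fin k → G) (g : G) (y : Fin (k + 1) → G) :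
    symOp c y (cfg h g) = trans (c h) y (cfg h g) := by
  have : (relTrans c).symm y = cfg h g ↔ y = fun i => c h * cfg h g i := by
    rw [Equiv.symm_apply_eq]
    simp only [relTrans, Equiv.coe_fn_mk, rel_cfg]
  simp only [symOp, trans, Matrix.of_apply, this]

lemma symOp_injective : Function.Injective (symOp (G := G) (k := k)) := by
  intro c c' hcc
  ext h
  have := congrFun (congrFun hcc (cfg h 1)) ((relTrans c).symm (cfg h 1))
  simp only [symOp, Matrix.of_apply, if_true] at this
  have h' : (relTrans c').symm (cfg h 1) = (relTrans c).symm (cfg h 1) := by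
    by_contra hne
    simp [hne] at this
  have := congrFun h' 0
  simpa [relTrans_symm_apply, rel_cfg, cfg_zero] using this.symm

end Symmetries

section Twirl

variable {G : Type} [Fintype G] [DecidableEq G] [CommGroup G] {k : ℕ}

lemma symOp_mulVec (c : (Fin k → G) → G) (v : Vec G (k + 1)) (x : Fin (k + 1) → G) :
    (symOp c).mulVec v x = v ((relTrans c).symm x) := by
  simp [symOp, Matrix.mulVec, dotProduct]

lemma symOp_conj_apply (c : (Fin k → G) → G) (ρ : Op G (k + 1)) (x y : Fin (k + 1) → G) :
    (symOp c * ρ * (symOp c)ᴴ) x y = ρ ((relTrans c).symm x) ((relTrans c).symm y) := by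
  simp [symOp, Matrix.mul_apply, Matrix.conjTranspose_apply, apply_ite (starRingEnd ℂ)]

lemma symOp_mem_unitaryGroup (c : (Fin k → G) → G) :
    symOp c ∈ Matrix.unitaryGroup (Fin (k + 1) → G) ℂ := by
  rw [Matrix.mem_unitaryGroup_iff, Matrix.star_eq_conjTranspose]
  ext x y
  simpa [Matrix.one_apply] using symOp_conj_apply c 1 x y

lemma Usym_eq_range : Usym G k = Set.range (symOp (G := G) (k := k)) := by
  ext U
  constructor
  · rintro ⟨-, c, hc⟩
    refine ⟨c, ?_⟩
    ext y x
    rw [← cfg_rel x, symOp_apply_cfg, ← mulVec_ket U, hc, mulVec_ket]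
  · rintro ⟨c, rfl⟩
    refine ⟨symOp_mem_unitaryGroup c, c, fun h g => ?_⟩
    ext y
    rw [mulVec_ket, mulVec_ket, symOp_apply_cfg]

lemma Piinv_apply (ρ : Op G (k + 1)) (x y : Fin (k + 1) → G) :
    Piinv G k ρ x y = (Fintype.card ((Fin k → G) → G) : ℂ)⁻¹ *
      ∑ c : (Fin k → G) → G, ρ ((relTrans c).symm x) ((relTrans c).symm y) := by
  rw [Piinv, Usym_eq_range, finsum_mem_range symOp_injective, finsum_eq_sum_of_fintype,
    Nat.card_range_of_injective symOp_injective, Nat.card_eq_fintype_card, Matrix.smul_apply,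
    Matrix.sum_apply, smul_eq_mul]
  simp only [symOp_conj_apply]

/-- The vector with amplitude `φ h` at the configuration `(c h, h (c h))`. -/
def alignedVec (c : (Fin k → G) → G) (φ : (Fin k → G) → ℂ) : Vec G (k + 1) :=
  fun x => if x 0 = c (rel x) then φ (rel x) else 0

lemma Alignable.exists_eq_alignedVec {ψ : Vec G (k + 1)} (hψ : Alignable ψ) :
    ∃ c φ, ψ = alignedVec c φ := by
  obtain ⟨i, θ, U, φ, hU, rfl⟩ := hψ
  rw [Usym_eq_range] at hU
  obtain ⟨c, rfl⟩ := hU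
  refine ⟨fun h => c h * (cfg h 1 i)⁻¹, fun h => Complex.exp (θ * Complex.I) *
    φ fun j => (cfg h 1 i)⁻¹ * cfg h 1 (i.succAbove j), ?_⟩
  ext x
  have hx (j : Fin (k + 1)) : x j = cfg (rel x) 1 j * x 0 := by
    conv_lhs => rw [← cfg_rel x]
    refine Fin.cases ?_ (fun l => ?_) j <;> simp [cfg]
  have hi : (c (rel x))⁻¹ * x i = 1 ↔ x 0 = c (rel x) * (cfg (rel x) 1 i)⁻¹ := by
    rw [hx i, inv_mul_eq_one, eq_mul_inv_iff_mul_eq, mul_comm (x 0), eq_comm]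
  simp only [Pi.smul_apply, symOp_mulVec, insVec, relTrans_symm_apply, hi, alignedVec,
    smul_eq_mul, mul_ite, mul_zero]
  split_ifs with h0
  · congr 2
    ext j
    rw [hx (i.succAbove j), h0]
    generalize cfg (rel x) 1 (i.succAbove j) = a
    generalize cfg (rel x) 1 i = b
    rw [mul_left_comm a, inv_mul_cancel_left, mul_comm]
  · rfl

lemma alignable_alignedVec_one (φ : (Fin k → G) → ℂ) :
    Alignable (alignedVec (1 : (Fin k → G) → G) φ) := by
  refine ⟨0, 0, symOp 1, φ, Usym_eq_range (G := G) ▸ Set.mem_range_self _, ?_⟩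
  ext x
  simp only [alignedVec, Pi.one_apply, Complex.ofReal_zero, zero_mul, Complex.exp_zero,
    one_smul, symOp_mulVec, insVec, relTrans_symm_apply, inv_one, one_mul]
  split_ifs with h
  · congr 1
    ext j
    simp [rel, h]
  · rfl

/-- The twirl of an aligned state: relational coherences survive between different relations
only, and every diagonal block becomes a multiple of the identity. -/
lemma Piinv_alignedVec (c : (Fin k → G) → G) (φ : (Fin k → G) → ℂ) :
    Piinv G k (outer (alignedVec c φ) (alignedVec c φ)) =
      (Fintype.card G : ℂ)⁻¹ • ∑ h, ∑ h',
        (φ h * (starRingEnd ℂ) (φ h')) • if h = h' then relProj h else relUnit h h' := by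
  ext x y
  have hG := card_ne_zero (G := G)
  have hC := Nat.cast_ne_zero (R := ℂ).2 (Fintype.card_ne_zero (α := (Fin k → G) → G))
  have hrhs : ((Fintype.card G : ℂ)⁻¹ • ∑ h, ∑ h', (φ h * (starRingEnd ℂ) (φ h')) •
      if h = h' then relProj h else relUnit h h') x y =
      (Fintype.card G : ℂ)⁻¹ * ((φ (rel x) * (starRingEnd ℂ) (φ (rel y))) *
        if rel x = rel y then (if x = y then 1 else 0) else (Fintype.card G : ℂ)⁻¹) := by
    simp only [Matrix.smul_apply, Matrix.sum_apply, smul_eq_mul]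
    rw [Finset.sum_eq_single (rel x), Finset.sum_eq_single (rel y)]
    · split_ifs <;> simp_all [relProj, relUnit_apply]
    · intro h' _ hh
      split_ifs with he
      · subst he
        have : x ≠ y := fun e => hh (e ▸ rfl)
        simp [relProj, this]
      · simp [relUnit_apply, Ne.symm hh]
    · simp
    · intro h _ hh
      refine Finset.sum_eq_zero fun h' _ => ?_
      split_ifs with he
      · simp [relProj, Matrix.diagonal_apply, Ne.symm hh]
      · simp [relUnit_apply, Ne.symm hh]
    · simp
  have hval (d : (Fin k → G) → G) (z : Fin (k + 1) → G) :
      alignedVec c φ ((relTrans d).symm z) =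
        if d (rel z) = z 0 * (c (rel z))⁻¹ then φ (rel z) else 0 := by
    have : (d (rel z))⁻¹ * z 0 = c (rel z) ↔ d (rel z) = z 0 * (c (rel z))⁻¹ := by
      rw [inv_mul_eq_iff_eq_mul, eq_mul_inv_iff_mul_eq, eq_comm]
    simp only [alignedVec, relTrans_symm_apply, rel_mul_left, this]
  rw [hrhs, Piinv_apply]
  simp only [outer, Matrix.of_apply, hval, apply_ite (starRingEnd ℂ), map_zero]
  split_ifs with hr hxy
  · subst hxy
    have := card_mul_sum_eval (fun g => if g = x 0 * (c (rel x))⁻¹ then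
      φ (rel x) * (starRingEnd ℂ) (φ (rel x)) else 0) (rel x)
    simp only [Finset.sum_ite_eq', Finset.mem_univ, if_true] at this
    simp only [ite_mul, mul_ite, zero_mul, mul_zero, ← ite_and, and_self]
    field_simp
    linear_combination this
  · have h0 : x 0 ≠ y 0 := fun h0 => hxy (ext_rel hr h0)
    rw [Finset.sum_eq_zero, mul_zero, mul_zero, mul_zero]
    intro d _
    rw [hr]
    by_cases h1 : d (rel y) = x 0 * (c (rel y))⁻¹
    · have : d (rel y) ≠ y 0 * (c (rel y))⁻¹ := by
        rw [h1]; simpa using h0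
      rw [if_neg this, mul_zero]
    · rw [if_neg h1, zero_mul]
  · have := card_sq_mul_sum_eval₂
      (fun g => if g = x 0 * (c (rel x))⁻¹ then φ (rel x) else 0)
      (fun g => if g = y 0 * (c (rel y))⁻¹ then (starRingEnd ℂ) (φ (rel y)) else 0) hr
    simp only [Finset.sum_ite_eq', Finset.mem_univ, if_true] at this
    field_simp
    linear_combination this

end Twirl

section Generation

variable {G : Type} [Fintype G] [DecidableEq G] [CommGroup G] {k : ℕ}

lemma Piinv_mem_algSubalgebra {ψ : Vec G (k + 1)} (hψ : Alignable ψ) :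
    Piinv G k (outer ψ ψ) ∈ algSubalgebra G k := by
  obtain ⟨c, φ, rfl⟩ := hψ.exists_eq_alignedVec
  rw [Piinv_alignedVec]
  refine SMulMemClass.smul_mem _ (sum_mem fun h _ => sum_mem fun h' _ =>
    SMulMemClass.smul_mem _ ?_)
  split_ifs
  · exact relProj_mem_algSubalgebra h
  · exact relUnit_mem_algSubalgebra h h'

variable {S : NonUnitalSubalgebra ℂ (Op G (k + 1))}

lemma sum_blocks_mem
    (hS : ∀ ψ : Vec G (k + 1), Alignable ψ → Piinv G k (outer ψ ψ) ∈ S)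
    (φ : (Fin k → G) → ℂ) :
    (∑ h, ∑ h', (φ h * (starRingEnd ℂ) (φ h')) •
      if h = h' then relProj h else relUnit h h') ∈ S := by
  have := SMulMemClass.smul_mem (Fintype.card G : ℂ) (hS _ (alignable_alignedVec_one φ))
  rwa [Piinv_alignedVec, smul_smul, mul_inv_cancel₀ card_ne_zero, one_smul] at this

lemma relProj_mem
    (hS : ∀ ψ : Vec G (k + 1), Alignable ψ → Piinv G k (outer ψ ψ) ∈ S)
    (h : Fin k → G) : relProj h ∈ S := by
  have := sum_blocks_mem hS (Pi.single h 1)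
  rw [Finset.sum_eq_single h, Finset.sum_eq_single h] at this
  · simpa using this
  all_goals simp +contextual

lemma relUnit_mem_of_ne
    (hS : ∀ ψ : Vec G (k + 1), Alignable ψ → Piinv G k (outer ψ ψ) ∈ S)
    {h h' : Fin k → G} (hne : h ≠ h') : relUnit h h' ∈ S := by
  have := mul_mem (mul_mem (relProj_mem hS h) (sum_blocks_mem hS 1)) (relProj_mem hS h')
  convert this using 1
  simp only [Pi.one_apply, map_one, mul_one, one_smul, Finset.mul_sum, Finset.sum_mul]
  have hterm (a b : Fin k → G) :
      relProj h * (if a = b then relProj a else relUnit a b) * relProj h' =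
        if h = a then (if b = h' then relUnit h h' else 0) else 0 := by
    split_ifs <;> simp_all [relProj_mul_relProj, relProj_mul_relUnit, relUnit_mul_relProj]
  simp only [hterm]
  simp

lemma relUnit_mem [Nontrivial (Fin k → G)]
    (hS : ∀ ψ : Vec G (k + 1), Alignable ψ → Piinv G k (outer ψ ψ) ∈ S)
    (h h' : Fin k → G) : relUnit h h' ∈ S := by
  obtain ⟨a, ha⟩ := exists_ne h
  by_cases hh : h = h'
  · subst hh
    have := mul_mem (relUnit_mem_of_ne hS ha.symm) (relUnit_mem_of_ne hS ha)
    simpa [relUnit_mul_relUnit] using this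
  · exact relUnit_mem_of_ne hS hh

end Generation

/-- For `N ≥ 2` and `|G| ≥ 2`, the smallest subset of `L(H_N)`
containing `Π_inv(|ψ⟩⟨ψ|)` for every alignable `ψ` and closed under complex linear
combinations and operator products (i.e. the non-unital subalgebra generated by these
twirled alignable states) is exactly `A_alg`. -/
theorem stmt12 (G : Type) [Fintype G] [DecidableEq G] [CommGroup G] (n : ℕ)
    (hn : 1 ≤ n) (hG : 2 ≤ Fintype.card G) :
    (NonUnitalAlgebra.adjoin ℂ
        {X : Op G (n + 1) | ∃ ψ : Vec G (n + 1), Alignable ψ ∧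
          X = Piinv G n (outer ψ ψ)} : Set (Op G (n + 1))) = Aalg G n := by
  apply Set.Subset.antisymm
  · refine NonUnitalAlgebra.adjoin_le (S := algSubalgebra G n) ?_
    rintro _ ⟨ψ, hψ, rfl⟩
    exact Piinv_mem_algSubalgebra hψ
  · rintro _ ⟨B, hB, a, rfl⟩
    have : Nontrivial G := Fintype.one_lt_card_iff_nontrivial.1 hG
    have : Nonempty (Fin n) := ⟨⟨0, hn⟩⟩
    have hS (ψ : Vec G (n + 1)) (hψ : Alignable ψ) :
        Piinv G n (outer ψ ψ) ∈ NonUnitalAlgebra.adjoin ℂ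
          {X : Op G (n + 1) | ∃ ψ : Vec G (n + 1), Alignable ψ ∧
            X = Piinv G n (outer ψ ψ)} :=
      NonUnitalAlgebra.subset_adjoin ℂ ⟨ψ, hψ, rfl⟩
    rw [Aphys, Set.mem_ofPred_eq, Piphys_mul_mul_Piphys] at hB
    rw [hB]
    refine add_mem (sum_mem fun h _ => sum_mem fun h' _ =>
      SMulMemClass.smul_mem _ (relUnit_mem hS h h')) (sum_mem fun h _ =>
        SMulMemClass.smul_mem _ ?_)
    rw [PiNot1_eq]
    exact sub_mem (relProj_mem hS h) (relUnit_mem hS h h)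

end QRF

end
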